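/- There exists a constant c such that for every n ≥ 1 there exists a language L_n over the binary alphabet {a, b} with the following properties: (1) the complement of L_n is finite; (2) L_n is accepted by an NFA with at most c·n² states; and (3) every partially ordered NFA (poNFA) accepting L_n has more than 2^{n−1} states. -/

import Mathlib

/-- State `q` is reachable from state `p` in the NFA `M`. -/
def NFA.Reach {α σ : Type*} (M : NFA α σ) (p q : σ) : Prop :=
  ∃ w : List α, q ∈ M.evalFrom {p} w

/-- An NFA is *partially ordered* (a poNFA) if the reachability relation is
antisymmetric, i.e., a partial order on the states. -/
def NFA.PartiallyOrdered {α σ : Type*} (M : NFA α σ) : Prop :=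
  ∀ p q : σ, M.Reach p q → M.Reach q p → p = q

namespace S15

theorem mem_cons {α σ : Type*} (M : NFA α σ) (p q : σ) (c : α) (w : List α) :
    q ∈ M.evalFrom {p} (c :: w) ↔ ∃ r ∈ M.step p c, q ∈ M.evalFrom {r} w := by
  rw [NFA.evalFrom_cons, NFA.stepSet_singleton, NFA.mem_evalFrom_iff_exists]

theorem mem_append {α σ : Type*} (M : NFA α σ) (p q : σ) (u w : List α) :
    q ∈ M.evalFrom {p} (u ++ w) ↔ ∃ r ∈ M.evalFrom {p} u, q ∈ M.evalFrom {r} w := by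
  rw [NFA.evalFrom_append, NFA.mem_evalFrom_iff_exists]

theorem loop_of {α σ : Type*} (M : NFA α σ) (h : M.PartiallyOrdered) (p : σ) (b : List α)
    (hb : p ∈ M.evalFrom {p} b) : ∀ c ∈ b, p ∈ M.step p c := by
  induction b with
  | nil => simp
  | cons c b ih =>
    obtain ⟨r, hr, hr2⟩ := (mem_cons ..).1 hb
    have : p = r := h p r ⟨[c], by simpa using hr⟩ ⟨b, hr2⟩
    subst this
    intro d hd
    rcases List.mem_cons.1 hd with rfl | hd
    · exact hr
    · exact ih hr2 d hd

theorem loop_eval {σ : Type*} (M : NFA Bool σ) (p : σ) (h : ∀ c, p ∈ M.step p c) (v : List Bool) :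
    p ∈ M.evalFrom {p} v := by
  induction v with
  | nil => simp
  | cons c v ih => exact (mem_cons ..).2 ⟨p, h c, ih⟩

theorem path_lemma {σ : Type*} [Fintype σ] (M : NFA Bool σ) (h : M.PartiallyOrdered)
    (bs : List (List Bool)) (hbs : ∀ b ∈ bs, ∀ c, c ∈ b) (p q : σ)
    (hq : q ∈ M.evalFrom {p} bs.flatten) :
    (∃ pre b post r, bs = pre ++ b :: post ∧ r ∈ M.evalFrom {p} pre.flatten ∧
      (∀ c, r ∈ M.step r c) ∧ q ∈ M.evalFrom {r} post.flatten) ∨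
    bs.length + 1 ≤ Set.ncard {r | M.Reach p r} := by
  induction bs generalizing p with
  | nil =>
    right
    have : p ∈ {r | M.Reach p r} := ⟨[], by simp⟩
    have := (Set.ncard_pos (Set.toFinite _)).2 ⟨p, this⟩
    simp only [List.length_nil]; omega
  | cons b bs ih =>
    rw [List.flatten_cons, mem_append] at hq
    obtain ⟨r, hr, hq⟩ := hq
    by_cases hpr : r = p
    · subst hpr
      left
      refine ⟨[], b, bs, r, rfl, by simp, fun c => loop_of M h r b hr c (hbs b (by simp) c), hq⟩
    · rcases ih (fun b hb => hbs b (by simp [hb])) r hq with ⟨pre, b1, post, r1, h1, h2, h3, h4⟩ | h1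
      · left
        refine ⟨b :: pre, b1, post, r1, by simp [h1], ?_, h3, h4⟩
        rw [List.flatten_cons, mem_append]
        exact ⟨r, hr, h2⟩
      · right
        have : Set.ncard {x | M.Reach r x} < Set.ncard {x | M.Reach p x} := by
          apply Set.ncard_lt_ncard _ (Set.toFinite _)
          rw [Set.ssubset_iff_of_subset]
          · refine ⟨p, ⟨[], by simp⟩, fun hx => hpr (h p r ⟨b, hr⟩ hx).symm⟩
          · rintro x ⟨w, hw⟩
            exact ⟨b ++ w, (mem_append ..).2 ⟨r, hr, hw⟩⟩
        simp only [List.length_cons]; omega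

theorem mul_add_mod_lt {q l r : ℕ} (h : r < l) : (q * l + r) % l = r := by
  rw [Nat.mul_add_mod', Nat.mod_eq_of_lt h]

def P (n r : ℕ) (x x' y y' : Bool) : Prop :=
  (r = 0 → x ≠ y) ∧ (r + 1 < n → ((x' ≠ y') ↔ (x = true ∧ y = false))) ∧
    (r + 1 = n → ¬ (x = true ∧ y = false))

instance (n r : ℕ) (x x' y y' : Bool) : Decidable (P n r x x' y y') := by unfold P; infer_instance

def V (n : ℕ) (w : List Bool) : Prop :=
  ∃ s, s + (n + 1) + 1 < w.length ∧ ¬ P n (s % (n + 1)) (w.getD s false) (w.getD (s + 1) false)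
    (w.getD (s + (n + 1)) false) (w.getD (s + (n + 1) + 1) false)

theorem sum_lt (n : ℕ) (g : ℕ → Bool) : ∑ r ∈ Finset.range n, (if g r then 2 ^ r else 0) < 2 ^ n := by
  induction n with
  | zero => simp
  | succ n ih => rw [Finset.sum_range_succ, pow_succ]; split_ifs <;> omega

theorem sum_succ (n : ℕ) (x y : ℕ → Bool) (h0 : x 0 ≠ y 0)
    (h : ∀ r, r + 1 < n → ((x (r+1) ≠ y (r+1)) ↔ (x r = true ∧ y r = false))) (j : ℕ) (hj : j < n) :
    ∑ r ∈ Finset.range (j+1), (if y r then 2 ^ r else 0)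
      + (if x j = true ∧ y j = false then 2 ^ (j+1) else 0) =
    ∑ r ∈ Finset.range (j+1), (if x r then 2 ^ r else 0) + 1 := by
  induction j with
  | zero => 
    revert h0
    cases hx : x 0 <;> cases hy : y 0 <;> simp [hx, hy]
  | succ j ih =>
    have ih := ih (by omega)
    have h := h j hj
    rw [Finset.sum_range_succ, Finset.sum_range_succ (fun r => if x r then 2 ^ r else 0)]
    have e : 2 ^ (j+1+1) = 2 * 2 ^ (j+1) := by ring
    rw [e]
    by_cases hc : x j = true ∧ y j = false
    · rw [if_pos hc] at ih
      have := h.2 hc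
      revert this
      cases x (j+1) <;> cases y (j+1) <;> simp <;> omega
    · rw [if_neg hc] at ih
      have := fun k => hc (h.1 k)
      revert this
      cases x (j+1) <;> cases y (j+1) <;> simp <;> omega

theorem bound (n : ℕ) (hn : 1 ≤ n) (w : List Bool) (hw : ¬ V n w) :
    w.length < (2 ^ n + 1) * (n + 1) := by
  by_contra hlen
  push Not at hlen
  have hP : ∀ s, s + (n + 1) + 1 < w.length → P n (s % (n + 1)) (w.getD s false)
      (w.getD (s + 1) false) (w.getD (s + (n + 1)) false) (w.getD (s + (n + 1) + 1) false) := by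
    intro s hs
    by_contra hc
    exact hw ⟨s, hs, hc⟩
  generalize (fun s => w.getD s false) = f at hP
  let val : ℕ → ℕ := fun q => ∑ r ∈ Finset.range n, (if w.getD (q * (n+1) + r) false then 2 ^ r else 0)
  have step : ∀ q, (q + 2) * (n + 1) ≤ w.length → val (q+1) = val q + 1 := by
    intro q hq
    have hP' : ∀ r, r < n → P n r (w.getD (q * (n+1) + r) false)
      (w.getD (q * (n+1) + (r + 1)) false) (w.getD ((q+1) * (n+1) + r) false)
      (w.getD ((q+1) * (n+1) + (r + 1)) false) := by
      intro r hr
      have := hP (q * (n+1) + r) (by nlinarith)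
      rw [mul_add_mod_lt (by omega)] at this
      convert this using 2 <;> ring
    obtain ⟨m, rfl⟩ : ∃ m, n = m + 1 := ⟨n - 1, by omega⟩
    have := sum_succ (m+1) (fun r => w.getD (q * (m+1+1) + r) false)
      (fun r => w.getD ((q+1) * (m+1+1) + r) false) ((hP' 0 (by omega)).1 rfl)
      (fun r hr => (hP' r (by omega)).2.1 hr) m (by omega)
    rw [if_neg ((hP' m (by omega)).2.2 rfl)] at this
    exact this
  have ge : ∀ q, (q + 1) * (n + 1) ≤ w.length → q ≤ val q := by
    intro q
    induction q with
    | zero => simp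
    | succ q ih =>
      intro hq
      have := ih (by nlinarith)
      rw [step q hq]; omega
  have h1 := ge (2 ^ n) hlen
  have h2 : val (2 ^ n) < 2 ^ n := sum_lt n _
  omega

theorem testBit_carry (q r : ℕ) : (q.testBit (r+1) ≠ (q+1).testBit (r+1)) ↔
    (q.testBit r = true ∧ (q+1).testBit r = false) := by
  induction r generalizing q with
  | zero =>
    simp only [Nat.testBit_succ, Nat.testBit_zero]
    rcases Nat.even_or_odd' q with ⟨k, rfl | rfl⟩
    · have : (2 * k + 1) / 2 = k := by omega
      simp [this]
    · have : (2 * k + 1) / 2 = k := by omega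
      have h2 : (2 * k + 1 + 1) / 2 = k + 1 := by omega
      simp only [this, h2]
      have : (2 * k + 1) % 2 = 1 := by omega
      have : (2 * k + 1 + 1) % 2 = 0 := by omega
      simp [*]
      omega
  | succ r ih =>
    rw [Nat.testBit_succ q, Nat.testBit_succ (q+1), Nat.testBit_succ q, Nat.testBit_succ (q+1)]
    rcases Nat.even_or_odd' q with ⟨k, rfl | rfl⟩
    · have : (2 * k + 1) / 2 = k := by omega
      have h2 : (2 * k ) / 2 = k := by omega
      simp only [this, h2]; simp
    · have : (2 * k + 1) / 2 = k := by omega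
      have h2 : (2 * k + 1 + 1) / 2 = k + 1 := by omega
      simp only [this, h2]
      exact ih k

theorem getD_flatten (l : ℕ) (bs : List (List Bool)) (h : ∀ b ∈ bs, b.length = l) (q r : ℕ) (hr : r < l) :
    bs.flatten.getD (q * l + r) false = (bs.getD q []).getD r false := by
  induction bs generalizing q with
  | nil => simp
  | cons b bs ih =>
    have hb : b.length = l := h b (by simp)
    cases q with
    | zero => simp [List.getElem?_append, hb, hr]
    | succ q =>
      have := ih (fun b hb => h b (by simp [hb])) q
      rw [List.flatten_cons, List.getD_append_right _ _ _ _ (by rw [hb]; nlinarith)]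
      rw [List.getD_cons_succ, ← this, hb]
      congr 1
      rw [Nat.sub_eq_iff_eq_add (by nlinarith)]; ring

theorem length_flatten (l : ℕ) (bs : List (List Bool)) (h : ∀ b ∈ bs, b.length = l) :
    bs.flatten.length = bs.length * l := by
  induction bs with
  | nil => simp
  | cons b bs ih =>
    rw [List.flatten_cons, List.length_append, ih (fun b hb => h b (by simp [hb])), h b (by simp)]
    simp; ring

theorem noV (n : ℕ) (bs : List (List Bool)) (h : ∀ b ∈ bs, b.length = n + 1)
    (hl : bs.length < 2 ^ n)
    (hb : ∀ q < bs.length, ∀ r < n, (bs.getD q []).getD r false = (q+1).testBit r) :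
    ¬ V n bs.flatten := by
  rintro ⟨s, hs, hP⟩
  apply hP
  rw [length_flatten _ _ h] at hs
  obtain ⟨q, r, hr, rfl⟩ : ∃ q r, r < n + 1 ∧ s = q * (n+1) + r :=
    ⟨s / (n+1), s % (n+1), Nat.mod_lt _ (by omega), (Nat.div_add_mod' s (n+1)).symm⟩
  rw [mul_add_mod_lt hr]
  have hq : q + 1 < bs.length := by
    by_contra hc
    have : bs.length * (n+1) ≤ (q+1) * (n+1) := Nat.mul_le_mul_right _ (by omega)
    nlinarith
  have e0 : r < n → bs.flatten.getD (q * (n+1) + r) false = (q+1).testBit r := fun h' => by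
    rw [getD_flatten _ _ h _ _ (by omega), hb _ (by omega) _ h']
  have e1 : r + 1 < n → bs.flatten.getD (q * (n+1) + r + 1) false = (q+1).testBit (r+1) := fun h' => by
    rw [add_assoc, getD_flatten _ _ h _ _ (by omega), hb _ (by omega) _ h']
  have e2 : r < n → bs.flatten.getD (q * (n+1) + r + (n+1)) false = (q+1+1).testBit r := fun h' => by
    rw [show q * (n+1) + r + (n+1) = (q+1) * (n+1) + r by ring,
      getD_flatten _ _ h _ _ (by omega), hb _ (by omega) _ h']
  have e3 : r + 1 < n → bs.flatten.getD (q * (n+1) + r + (n+1) + 1) false = (q+1+1).testBit (r+1) := fun h' => by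
    rw [show q * (n+1) + r + (n+1) + 1 = (q+1) * (n+1) + (r + 1) by ring,
      getD_flatten _ _ h _ _ (by omega), hb _ (by omega) _ h']
  refine ⟨fun h0 => ?_, fun h1 => ?_, fun h2 => ?_⟩
  · subst h0
    rcases Nat.eq_zero_or_pos n with rfl | hn
    · rw [pow_zero] at hl; omega
    rw [e0 hn, e2 hn]
    simp [Nat.testBit_zero]; omega
  · rw [e0 (by omega), e1 h1, e2 (by omega), e3 h1]
    exact testBit_carry _ _
  · rw [e0 (by omega), e2 (by omega), ← testBit_carry, h2, Nat.testBit_lt_two_pow (by omega), Nat.testBit_lt_two_pow (by omega)]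
    simp

abbrev Mach (n : ℕ) := Fin (n+1) × Fin (n+4) × Bool × Bool × Bool × Bool

def mstep (n : ℕ) (m : Mach n) (c : Bool) : Mach n :=
  (m.1, ⟨min (m.2.1.val + 1) (n+3), by omega⟩,
    if m.2.1.val = 0 then c else m.2.2.1,
    if m.2.1.val = 1 then c else m.2.2.2.1,
    if m.2.1.val = n + 1 then c else m.2.2.2.2.1,
    if m.2.1.val = n + 2 then c else m.2.2.2.2.2)

def minit (n : ℕ) (i : Fin (n+1)) : Mach n := (i, 0, false, false, false, false)

def macc (n : ℕ) (m : Mach n) : Prop :=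
  m.2.1.val = n + 3 ∧ ¬ P n m.1.val m.2.2.1 m.2.2.2.1 m.2.2.2.2.1 m.2.2.2.2.2

theorem getD_snoc (v : List Bool) (c : Bool) (k : ℕ) :
    (v ++ [c]).getD k false = if v.length = k then c else v.getD k false := by
  rcases lt_trichotomy k v.length with h | h | h
  · rw [List.getD_append _ _ _ _ h, if_neg (by omega)]
  · subst h; simp
  · rw [if_neg (by omega), List.getD_eq_default _ _ (by simp; omega),
      List.getD_eq_default _ _ (by omega)]

theorem mfold (n : ℕ) (i : Fin (n+1)) (v : List Bool) :
    v.foldl (mstep n) (minit n i) = (i, ⟨min v.length (n+3), by omega⟩, v.getD 0 false,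
      v.getD 1 false, v.getD (n+1) false, v.getD (n+2) false) := by
  induction v using List.reverseRecOn with
  | nil => simp [minit]
  | append_singleton v c ih =>
    rw [List.foldl_append, ih]
    simp only [List.foldl_cons, List.foldl_nil, mstep, getD_snoc]
    have e : ∀ k, k < n + 3 → (min v.length (n+3) = k ↔ v.length = k) := by intro k hk; omega
    rw [if_congr (e 0 (by omega)) rfl rfl, if_congr (e 1 (by omega)) rfl rfl,
      if_congr (e (n+1) (by omega)) rfl rfl, if_congr (e (n+2) (by omega)) rfl rfl]
    have : min (min v.length (n+3) + 1) (n+3) = min (v ++ [c]).length (n+3) := by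
      simp
    simp only [this]

def N (n : ℕ) (p : Bool) : NFA Bool (Fin (n+1) ⊕ (Mach n ⊕ Bool)) where
  step := fun s c => match s with
    | .inl i => {.inl (i+1), .inr (.inl (mstep n (minit n i) c))}
    | .inr (.inl m) => {.inr (.inl (mstep n m c))}
    | .inr (.inr b) => {.inr (.inr (xor b c))}
  start := {.inl 0, .inr (.inr false)}
  accept := {s | match s with
    | .inl _ => False
    | .inr (.inl m) => macc n m
    | .inr (.inr b) => b = p}

theorem accFrom_cons {α σ : Type*} (M : NFA α σ) (p : σ) (c : α) (w : List α) :
    (∃ q ∈ M.accept, q ∈ M.evalFrom {p} (c :: w)) ↔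
      ∃ r ∈ M.step p c, ∃ q ∈ M.accept, q ∈ M.evalFrom {r} w := by
  simp only [mem_cons]; tauto

theorem N_mach (n : ℕ) (p : Bool) (m : Mach n) (w : List Bool) :
    (∃ q ∈ (N n p).accept, q ∈ (N n p).evalFrom {.inr (.inl m)} w) ↔
      macc n (w.foldl (mstep n) m) := by
  induction w generalizing m with
  | nil => simp [N]
  | cons c w ih =>
    rw [accFrom_cons, List.foldl_cons, ← ih]
    simp [N]

theorem N_par (n : ℕ) (p : Bool) (b : Bool) (w : List Bool) :
    (∃ q ∈ (N n p).accept, q ∈ (N n p).evalFrom {.inr (.inr b)} w) ↔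
      w.foldl xor b = p := by
  induction w generalizing b with
  | nil => simp [N]
  | cons c w ih =>
    rw [accFrom_cons, List.foldl_cons, ← ih]
    simp [N]

theorem N_wait (n : ℕ) (p : Bool) (s : ℕ) (w : List Bool) :
    (∃ q ∈ (N n p).accept, q ∈ (N n p).evalFrom {.inl (Fin.ofNat (n+1) s)} w) ↔
      ∃ k, macc n ((w.drop k).foldl (mstep n) (minit n (Fin.ofNat (n+1) (s + k)))) := by
  induction w generalizing s with
  | nil => simp [N, macc, minit]
  | cons c w ih =>
    rw [accFrom_cons]
    have hs : Fin.ofNat (n+1) s + 1 = Fin.ofNat (n+1) (s+1) := by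
      ext; simp [Fin.val_add]
    have : (N n p).step (.inl (Fin.ofNat (n+1) s)) c = {.inl (Fin.ofNat (n+1) (s+1)),
      .inr (.inl (mstep n (minit n (Fin.ofNat (n+1) s)) c))} := by
      rw [← hs]; rfl
    rw [this]
    simp only [Set.mem_insert_iff, Set.mem_singleton_iff, exists_eq_or_imp, exists_eq_left]
    rw [ih, N_mach]
    constructor
    · rintro (⟨k, hk⟩ | h)
      · refine ⟨k + 1, ?_⟩
        rw [show s + (k + 1) = s + 1 + k by ring]
        simpa using hk
      · exact ⟨0, by simpa using h⟩
    · rintro ⟨k, hk⟩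
      cases k with
      | zero => right; simpa using hk
      | succ k =>
        left; refine ⟨k, ?_⟩
        rw [show s + 1 + k = s + (k + 1) by ring]
        simpa using hk

theorem N_accepts (n : ℕ) (p : Bool) (w : List Bool) :
    w ∈ (N n p).accepts ↔ V n w ∨ w.foldl xor false = p := by
  have h0 : w ∈ (N n p).accepts ↔ (∃ q ∈ (N n p).accept, q ∈ (N n p).evalFrom {.inl 0} w) ∨
      (∃ q ∈ (N n p).accept, q ∈ (N n p).evalFrom {.inr (.inr false)} w) := by
    rw [NFA.mem_accepts]
    have : (N n p).start = {.inl 0} ∪ {.inr (.inr false)} := rfl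
    rw [this]
    simp only [NFA.evalFrom_union, Set.mem_union]
    constructor
    · rintro ⟨q, h, h1 | h1⟩
      · exact Or.inl ⟨q, h, h1⟩
      · exact Or.inr ⟨q, h, h1⟩
    · rintro (⟨q, h, h1⟩ | ⟨q, h, h1⟩)
      · exact ⟨q, h, Or.inl h1⟩
      · exact ⟨q, h, Or.inr h1⟩
  rw [h0, N_par]
  have h1 := N_wait n p 0 w
  have h2 : Fin.ofNat (n+1) 0 = 0 := rfl
  rw [h2] at h1
  rw [h1]
  apply or_congr_left
  unfold V
  apply exists_congr
  intro k
  rw [mfold]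
  simp only [macc, zero_add, Fin.val_ofNat, List.getD_eq_getElem?_getD, List.getElem?_drop, List.length_drop]
  rw [show k + (n+1) + 1 = k + (n + 2) by ring]
  apply and_congr
  · omega
  · rfl

theorem to_fin {σ : Type} [Fintype σ] (M : NFA Bool σ) :
    ∃ B : NFA Bool (Fin (Fintype.card σ)), ∀ w, w ∈ B.accepts ↔ w ∈ M.accepts := by
  let e := Fintype.equivFin σ
  let B : NFA Bool (Fin (Fintype.card σ)) :=
    ⟨fun i c => {j | e.symm j ∈ M.step (e.symm i) c}, {i | e.symm i ∈ M.start},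
      {i | e.symm i ∈ M.accept}⟩
  refine ⟨B, fun w => ?_⟩
  have key : ∀ (w : List Bool) (p q : σ), e q ∈ B.evalFrom {e p} w ↔ q ∈ M.evalFrom {p} w := by
    intro w
    induction w with
    | nil => simp
    | cons c w ih =>
      intro p q
      rw [mem_cons, mem_cons]
      rw [← e.exists_congr_right]
      apply exists_congr
      intro r
      rw [ih]
      simp [B]
  rw [NFA.mem_accepts, NFA.mem_accepts]
  rw [← e.exists_congr_right]
  apply exists_congr
  intro q
  rw [NFA.mem_evalFrom_iff_exists, NFA.mem_evalFrom_iff_exists (S := M.start), ← e.exists_congr_right]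
  simp only [key]
  simp [B]

theorem par_acc (b : Bool) (w : List Bool) : w.foldl xor b = xor b (w.foldl xor false) := by
  induction w generalizing b with
  | nil => simp
  | cons c w ih => 
    rw [List.foldl_cons, List.foldl_cons, ih, ih (xor false c)]; simp

def blk (n q : ℕ) (t : Bool) : List Bool := (List.range n).map (fun r => q.testBit r) ++ [t]

def blks (n : ℕ) : List (List Bool) := (List.range (2 ^ n - 1)).map (fun q => blk n (q+1) false)

theorem blk_getD (n q : ℕ) (t : Bool) (r : ℕ) (hr : r < n) : (blk n q t).getD r false = q.testBit r := by
  unfold blk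
  rw [List.getD_append _ _ _ _ (by simpa using hr)]
  simp [hr]

theorem blks_mem (n : ℕ) (b : List Bool) (hb : b ∈ blks n) (c : Bool) : c ∈ b := by
  simp only [blks, List.mem_map, List.mem_range] at hb
  obtain ⟨q, hq, rfl⟩ := hb
  cases c with
  | false => simp [blk]
  | true =>
    obtain ⟨i, hi⟩ := Nat.exists_testBit_of_ne_zero (x := q+1) (by omega)
    have : i < n := by
      by_contra hc
      have h1 : 2 ^ n ≤ 2 ^ i := Nat.pow_le_pow_right (by omega) (by omega)
      rw [Nat.testBit_lt_two_pow (by omega)] at hi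
      simp at hi
    simp only [blk, List.mem_append, List.mem_map, List.mem_range]
    exact Or.inl ⟨i, this, hi⟩

theorem main (n : ℕ) (pre post : List (List Bool)) (b : List Bool) (h : blks n = pre ++ b :: post) :
    ∃ b' : List Bool, ¬ V n (pre ++ b' :: post).flatten ∧
      (pre ++ b' :: post).flatten.foldl xor false ≠ (blks n).flatten.foldl xor false := by
  have hlen : (blks n).length = 2 ^ n - 1 := by simp [blks]
  have hget : ∀ q < 2 ^ n - 1, (blks n).getD q [] = blk n (q+1) false := by
    intro q hq; simp [blks, hq]
  have hl : ∀ b ∈ blks n, b.length = n + 1 := by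
    intro b hb
    simp only [blks, List.mem_map] at hb
    obtain ⟨q, _, rfl⟩ := hb
    simp [blk]
  have hp : pre.length < 2 ^ n - 1 := by rw [← hlen, h]; simp
  have hb : b = blk n (pre.length + 1) false := by
    rw [← hget _ hp, h]; simp
  have hlen' : ∀ b', (pre ++ b' :: post).length = 2 ^ n - 1 := by
    intro b'; rw [← hlen, h]; simp
  refine ⟨blk n (pre.length + 1) true, ?_, ?_⟩
  · apply noV
    · intro b1 hb1
      simp only [List.mem_append, List.mem_cons] at hb1
      rcases hb1 with h1 | rfl | h1
      · exact hl _ (by simp [h, h1])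
      · simp [blk]
      · exact hl _ (by simp [h, h1])
    · rw [hlen']; have := Nat.one_le_two_pow (n := n); omega
    · rw [hlen']
      intro q hq r hr
      by_cases hqp : q = pre.length
      · subst hqp
        rw [List.getD_append_right _ _ _ _ le_rfl]
        simp only [Nat.sub_self, List.getD_cons_zero]
        exact blk_getD _ _ _ _ hr
      · have : (pre ++ blk n (pre.length + 1) true :: post).getD q [] = (blks n).getD q [] := by
          rw [h]
          rcases Nat.lt_or_gt_of_ne hqp with h1 | h1
          · rw [List.getD_append _ _ _ _ h1, List.getD_append _ _ _ _ h1]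
          · rw [List.getD_append_right _ _ _ _ h1.le, List.getD_append_right _ _ _ _ h1.le]
            obtain ⟨k, hk⟩ : ∃ k, q - pre.length = k + 1 := ⟨q - pre.length - 1, by omega⟩
            rw [hk]; simp
        rw [this, hget q hq, blk_getD _ _ _ _ hr]
  · rw [h, hb]
    simp only [List.flatten_append, List.flatten_cons, List.foldl_append, blk, List.foldl_cons, List.foldl_nil]
    rw [par_acc, par_acc (xor _ false)]
    generalize List.foldl xor _ _ = x
    generalize List.foldl xor _ _ = y
    cases x <;> cases y <;> simp

end S15

/-- There is a constant `c` such that for every `n ≥ 1` there is a language `L_n`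
over the binary alphabet (`Bool`) whose complement is finite, which is accepted by
an NFA with at most `c·n²` states, while every partially ordered NFA accepting it
has more than `2^(n-1)` states. -/
theorem stmt_15 :
    ∃ c : ℕ, ∀ n : ℕ, 1 ≤ n →
      ∃ L : Set (List Bool),
        Set.Finite { w : List Bool | w ∉ L } ∧
        (∃ (k : ℕ) (B : NFA Bool (Fin k)), k ≤ c * n ^ 2 ∧
          ∀ w : List Bool, w ∈ B.accepts ↔ w ∈ L) ∧
        (∀ (σ : Type) [Fintype σ] (B : NFA Bool σ), B.PartiallyOrdered →
          (∀ w : List Bool, w ∈ B.accepts ↔ w ∈ L) →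
            2 ^ (n - 1) < Fintype.card σ) := by
  refine ⟨200, fun n hn => ?_⟩
  refine ⟨{w | S15.V n w ∨ w.foldl xor false = (S15.blks n).flatten.foldl xor false}, ?_, ?_, ?_⟩
  · apply (List.finite_length_lt Bool ((2 ^ n + 1) * (n + 1))).subset
    intro w hw
    apply S15.bound n hn w
    intro hV
    exact hw (Or.inl hV)
  · obtain ⟨B, hB⟩ := S15.to_fin (S15.N n ((S15.blks n).flatten.foldl xor false))
    refine ⟨_, B, ?_, fun w => (hB w).trans (S15.N_accepts n _ w)⟩
    simp only [Fintype.card_sum, Fintype.card_prod, Fintype.card_fin, Fintype.card_bool]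
    nlinarith
  · intro σ _ B hpo hB
    have hacc := (hB (S15.blks n).flatten).2 (Or.inr rfl)
    rw [NFA.mem_accepts] at hacc
    obtain ⟨q, hq, hq2⟩ := hacc
    rw [NFA.mem_evalFrom_iff_exists] at hq2
    obtain ⟨p, hp, hpq⟩ := hq2
    rcases S15.path_lemma B hpo _ (S15.blks_mem n) p q hpq with
      ⟨pre, b, post, r, h1, h2, h3, h4⟩ | h
    · exfalso
      obtain ⟨b', hV, hpar⟩ := S15.main n pre post b h1
      have : (pre ++ b' :: post).flatten ∈ B.accepts := by
        rw [NFA.mem_accepts]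
        refine ⟨q, hq, ?_⟩
        rw [NFA.mem_evalFrom_iff_exists]
        refine ⟨p, hp, ?_⟩
        rw [List.flatten_append, List.flatten_cons, S15.mem_append]
        refine ⟨r, h2, ?_⟩
        rw [S15.mem_append]
        exact ⟨r, S15.loop_eval B r h3 b', h4⟩
      rcases (hB _).1 this with h | h
      · exact hV h
      · exact hpar h
    · have h5 : Set.ncard {r | B.Reach p r} ≤ Fintype.card σ := by
        rw [← Nat.card_eq_fintype_card]; exact Set.ncard_le_card _
      have h6 : (S15.blks n).length = 2 ^ n - 1 := by simp [S15.blks]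
      have h7 : 2 ^ (n - 1) < 2 ^ n := Nat.pow_lt_pow_right (by omega) (by omega)
      omega
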